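/- arXiv:math/0411070 — 3 statements merged into one kernel-verified Lean document; each statement's English description precedes it below -/
import Mathlib

section
/- Euler–Lagrange derivative of a density linear in gauge parameters: for every finitely supported family g : M → R and every r ∈ ρ, the Euler–Lagrange derivative in R' at the parameter index Sum.inr r of the element Σ_Ξ ι̂(g_Ξ) · ξ^r_Ξ equals Σ_Ξ (−1)^{|Ξ|} · ι̂(d_Ξ(g_Ξ)); that is, Σ_Λ (−1)^{|Λ|} · d'_Λ(pderiv (Sum.inr r, Λ) (Σ_Ξ ι̂(g_Ξ) · ξ^r_Ξ)) = Σ_Ξ (−1)^{|Ξ|} · ι̂(d_Ξ(g_Ξ)). -/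
/-- Size `|Λ|` of a multi-index. -/
def msize {n : ℕ} (Λ : Fin n →₀ ℕ) : ℕ := ∑ i, Λ i

/-- Iterated derivative `d_Λ = ∏ λ (d λ)^[Λ λ]` (well defined for commuting `d λ`). -/
def dIter {R : Type*} {n : ℕ} (d : Fin n → R → R) (Λ : Fin n →₀ ℕ) : R → R :=
  (List.finRange n).foldr (fun i acc => (d i)^[Λ i] ∘ acc) id

/-- The total derivative `d_λ` on the ring of differential polynomials
`MvPolynomial (τ × M) k`, the unique `k`-derivation with
`d_λ (X (j, Λ)) = X (j, Λ + e_λ)`. -/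
noncomputable def totalDeriv (k : Type*) [CommRing k] {n : ℕ} (τ : Type*) (l : Fin n) :
    Derivation k (MvPolynomial (τ × (Fin n →₀ ℕ)) k) (MvPolynomial (τ × (Fin n →₀ ℕ)) k) :=
  MvPolynomial.mkDerivation k fun p => MvPolynomial.X (p.1, p.2 + Finsupp.single l 1)

/-- The `k`-algebra embedding `ι̂ : R → R'` induced by `(i, Λ) ↦ (Sum.inl i, Λ)`. -/
noncomputable def fieldEmb (k : Type*) [CommRing k] {n : ℕ} (ι ρ : Type*) :
    MvPolynomial (ι × (Fin n →₀ ℕ)) k →ₐ[k] MvPolynomial ((ι ⊕ ρ) × (Fin n →₀ ℕ)) k :=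
  MvPolynomial.rename fun p => (Sum.inl p.1, p.2)

theorem emb_totalDeriv (k : Type*) [CommRing k] {n : ℕ} (ι ρ : Type*) (l : Fin n)
    (p : MvPolynomial (ι × (Fin n →₀ ℕ)) k) :
    totalDeriv k (ι ⊕ ρ) l (fieldEmb k ι ρ p) = fieldEmb k ι ρ (totalDeriv k ι l p) := by
  induction p using MvPolynomial.induction_on with
  | C a =>
    simp only [fieldEmb, totalDeriv, MvPolynomial.rename_C, MvPolynomial.derivation_C, map_zero]
  | add p q hp hq => simp only [map_add, hp, hq]
  | mul_X p i hp =>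
    have hX : totalDeriv k (ι ⊕ ρ) l (fieldEmb k ι ρ (MvPolynomial.X i)) =
        fieldEmb k ι ρ (totalDeriv k ι l (MvPolynomial.X i)) := by
      simp only [fieldEmb, totalDeriv, MvPolynomial.rename_X, MvPolynomial.mkDerivation_X]
    simp only [map_mul, map_add, Derivation.leibniz, smul_eq_mul, hp, hX]

theorem emb_dIter (k : Type*) [CommRing k] {n : ℕ} (ι ρ : Type*) (Λ : Fin n →₀ ℕ)
    (p : MvPolynomial (ι × (Fin n →₀ ℕ)) k) :
    dIter (fun l => ⇑(totalDeriv k (ι ⊕ ρ) l)) Λ (fieldEmb k ι ρ p) =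
      fieldEmb k ι ρ (dIter (fun l => ⇑(totalDeriv k ι l)) Λ p) := by
  unfold dIter
  induction List.finRange n with
  | nil => rfl
  | cons i L ih =>
    simp only [List.foldr_cons, Function.comp_apply]
    rw [ih]
    exact ((Function.Semiconj.iterate_right (f := fieldEmb k ι ρ)
      (fun x => (emb_totalDeriv k ι ρ i x).symm) (Λ i)) _).symm

theorem pderiv_emb (k : Type*) [CommRing k] {n : ℕ} (ι ρ : Type*) (r : ρ) (Λ : Fin n →₀ ℕ)
    (p : MvPolynomial (ι × (Fin n →₀ ℕ)) k) :
    MvPolynomial.pderiv ((Sum.inr r : ι ⊕ ρ), Λ) (fieldEmb k ι ρ p) = 0 := by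
  induction p using MvPolynomial.induction_on with
  | C a => simp only [fieldEmb, MvPolynomial.rename_C, MvPolynomial.pderiv_C]
  | add p q hp hq => simp only [map_add, hp, hq, add_zero]
  | mul_X p i hp =>
    have hX : MvPolynomial.pderiv ((Sum.inr r : ι ⊕ ρ), Λ)
        (fieldEmb k ι ρ (MvPolynomial.X i)) = 0 := by
      simp only [fieldEmb, MvPolynomial.rename_X]
      exact MvPolynomial.pderiv_X_of_ne (by simp)
    simp only [map_mul, Derivation.leibniz, hp, hX, smul_zero, add_zero]

/-- Euler–Lagrange derivative of a density linear in gauge parameters: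
the Euler–Lagrange derivative in `R'` at the parameter index `Sum.inr r` of
`∑_Ξ ι̂(g_Ξ) ξ^r_Ξ` equals `∑_Ξ (-1)^{|Ξ|} ι̂(d_Ξ (g_Ξ))`. -/
theorem EL_of_linear_density (k : Type*) [CommRing k] (n : ℕ) (hn : 1 ≤ n)
    (ι ρ : Type*) (g : (Fin n →₀ ℕ) → MvPolynomial (ι × (Fin n →₀ ℕ)) k)
    (hg : (Function.support g).Finite) (r : ρ) :
    (∑ᶠ Λ : Fin n →₀ ℕ,
        (-1 : MvPolynomial ((ι ⊕ ρ) × (Fin n →₀ ℕ)) k) ^ msize Λ *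
          dIter (fun l => ⇑(totalDeriv k (ι ⊕ ρ) l)) Λ
            (MvPolynomial.pderiv ((Sum.inr r : ι ⊕ ρ), Λ)
              (∑ᶠ Ξ : Fin n →₀ ℕ,
                fieldEmb k ι ρ (g Ξ) * MvPolynomial.X ((Sum.inr r : ι ⊕ ρ), Ξ))))
      = ∑ᶠ Ξ : Fin n →₀ ℕ,
          (-1 : MvPolynomial ((ι ⊕ ρ) × (Fin n →₀ ℕ)) k) ^ msize Ξ *
            fieldEmb k ι ρ (dIter (fun l => ⇑(totalDeriv k ι l)) Ξ (g Ξ)) := by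
  classical
  refine finsum_congr fun Λ => ?_
  rw [← emb_dIter]
  congr 2
  have hs : (Function.support fun Ξ : Fin n →₀ ℕ =>
      fieldEmb k ι ρ (g Ξ) * MvPolynomial.X ((Sum.inr r : ι ⊕ ρ), Ξ)) ⊆ hg.toFinset := by
    intro Ξ h
    simp only [Set.Finite.coe_toFinset, Function.mem_support] at h ⊢
    intro h0
    exact h (by rw [h0, map_zero, zero_mul])
  rw [finsum_eq_sum_of_support_subset _ hs, map_sum, Finset.sum_eq_single Λ]
  · simp [Derivation.leibniz, pderiv_emb, MvPolynomial.pderiv_X_self]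
  · intro Ξ _ hne
    rw [Derivation.leibniz, pderiv_emb, MvPolynomial.pderiv_X_of_ne (by simpa using hne),
      smul_zero, smul_zero, add_zero]
  · intro h
    have h0 : g Λ = 0 := by simpa using h
    rw [h0, map_zero, zero_mul, map_zero]
end

section
/- Noether's second theorem, direct part (Theorem 0510): let L ∈ R be a Lagrangian and let the finitely supported family υ = (υ^{i,Ξ}_r) of elements of R be a gauge symmetry of L, i.e. Σ_{i,r,Ξ} ι̂(υ^{i,Ξ}_r) · ξ^r_Ξ · ι̂(E_i(L)) is a total divergence in R'. Then the Noether identity holds: for every r ∈ ρ, Σ_{i,Λ} Δ^{i,Λ}_r · d_Λ(E_i(L)) = 0 in R, where the Noether operator coefficients are Δ^{i,Λ}_r := Σ_{Σ∈M} (−1)^{|Σ+Λ|} · C(Σ+Λ,Σ) · d_Σ(υ^{i,Σ+Λ}_r) and C(Λ,Σ) := ∏_λ Nat.choose (Λ(λ)) (Σ(λ)). -/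
/-- Multi-index binomial coefficient `C(Λ, T) = ∏ λ, choose (Λ λ) (T λ)`. -/
def mchoose {n : ℕ} (Λ T : Fin n →₀ ℕ) : ℕ := ∏ i, (Λ i).choose (T i)

/-- The Euler–Lagrange derivative `E_i (L) = ∑_Λ (-1)^{|Λ|} d_Λ (∂_{(i,Λ)} L)`. -/
noncomputable def EL (k : Type*) [CommRing k] {n : ℕ} (ι : Type*) (i : ι)
    (L : MvPolynomial (ι × (Fin n →₀ ℕ)) k) : MvPolynomial (ι × (Fin n →₀ ℕ)) k :=
  ∑ᶠ Λ : Fin n →₀ ℕ, (-1 : MvPolynomial (ι × (Fin n →₀ ℕ)) k) ^ msize Λ *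
    dIter (fun l => ⇑(totalDeriv k ι l)) Λ (MvPolynomial.pderiv (i, Λ) L)

/-- An element of `MvPolynomial (τ × M) k` is a total divergence if it equals
`∑_λ d_λ (σ^λ)` for some `σ^λ`. -/
def IsTotalDiv (k : Type*) [CommRing k] {n : ℕ} {τ : Type*}
    (f : MvPolynomial (τ × (Fin n →₀ ℕ)) k) : Prop :=
  ∃ σ : Fin n → MvPolynomial (τ × (Fin n →₀ ℕ)) k, f = ∑ l, totalDeriv k τ l (σ l)

/-- A finitely supported family `υ = (υ^{i,Ξ}_r)` is a gauge symmetry of `L` if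
`∑_{i,r,Ξ} ι̂(υ^{i,Ξ}_r) ξ^r_Ξ ι̂(E_i(L))` is a total divergence in `R'`. -/
def IsGaugeSymmetry (k : Type*) [CommRing k] {n : ℕ} (ι ρ : Type*)
    (υ : ι → ρ → (Fin n →₀ ℕ) → MvPolynomial (ι × (Fin n →₀ ℕ)) k)
    (L : MvPolynomial (ι × (Fin n →₀ ℕ)) k) : Prop :=
  IsTotalDiv k (∑ᶠ p : ι × ρ × (Fin n →₀ ℕ),
    fieldEmb k ι ρ (υ p.1 p.2.1 p.2.2) * MvPolynomial.X ((Sum.inr p.2.1 : ι ⊕ ρ), p.2.2) *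
      fieldEmb k ι ρ (EL k ι p.1 L))

open MvPolynomial

theorem mi_induction {n : ℕ} {P : (Fin n →₀ ℕ) → Prop} (h0 : P 0)
    (hs : ∀ Λ l, P Λ → P (Λ + Finsupp.single l 1)) (Λ : Fin n →₀ ℕ) : P Λ := by
  have key : ∀ (l : Fin n) (m : ℕ) (Λ : Fin n →₀ ℕ), P Λ → P (Λ + Finsupp.single l m) := by
    intro l m
    induction m with
    | zero => intro Λ h; simpa using h
    | succ m ih =>
      intro Λ h
      rw [Finsupp.single_add, ← add_assoc]
      exact hs _ _ (ih _ h)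
  induction Λ using Finsupp.induction with
  | zero => exact h0
  | single_add a b f _ _ ih => rw [add_comm]; exact key a b f ih

theorem foldr_succ_aux {R : Type*} {n : ℕ} (d : Fin n → R → R)
    (hc : ∀ i j, Function.Commute (d i) (d j)) (Λ : Fin n →₀ ℕ) (l : Fin n) (L : List (Fin n))
    (hL : L.Nodup) (f : R) :
    L.foldr (fun i acc => (d i)^[(Λ + Finsupp.single l 1 : Fin n →₀ ℕ) i] ∘ acc) id f =
      if l ∈ L then d l (L.foldr (fun i acc => (d i)^[Λ i] ∘ acc) id f)
      else L.foldr (fun i acc => (d i)^[Λ i] ∘ acc) id f := by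
  induction L with
  | nil => simp
  | cons a L ih =>
    rw [List.nodup_cons] at hL
    have ih := ih hL.2
    simp only [List.foldr_cons, Function.comp_apply, ih]
    by_cases h : l = a
    · subst h
      simp [hL.1, Function.iterate_succ_apply']
    · have h' : (Λ + Finsupp.single l 1 : Fin n →₀ ℕ) a = Λ a := by simp [Finsupp.single_apply, h]
      rw [h']
      by_cases hm : l ∈ L
      · simp only [hm, if_true, List.mem_cons, or_true]
        exact ((hc a l).iterate_left (Λ a)).eq _
      · simp [hm, h]

theorem dIter_succ {R : Type*} {n : ℕ} (d : Fin n → R → R)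
    (hc : ∀ i j, Function.Commute (d i) (d j)) (Λ : Fin n →₀ ℕ) (l : Fin n) (f : R) :
    dIter d (Λ + Finsupp.single l 1) f = d l (dIter d Λ f) := by
  unfold dIter
  rw [foldr_succ_aux d hc Λ l _ (List.nodup_finRange n)]
  simp

theorem dIter_zero {R : Type*} {n : ℕ} (d : Fin n → R → R) (f : R) :
    dIter d 0 f = f := by
  unfold dIter
  induction List.finRange n with
  | nil => rfl
  | cons a L ih => simpa using ih

section
variable {k : Type*} [CommRing k] {n : ℕ} {τ : Type*}

theorem totalDeriv_X (l : Fin n) (p : τ × (Fin n →₀ ℕ)) :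
    totalDeriv k τ l (X p) = X (p.1, p.2 + Finsupp.single l 1) := by
  simp [totalDeriv, mkDerivation_X]

theorem totalDeriv_comm (i j : Fin n) :
    Function.Commute (⇑(totalDeriv k τ i)) (⇑(totalDeriv k τ j)) := by
  have h : ⁅totalDeriv k τ i, totalDeriv k τ j⁆ = 0 := by
    apply MvPolynomial.derivation_ext
    intro p
    simp [Derivation.commutator_apply, totalDeriv_X, add_right_comm]
  intro f
  have := DFunLike.congr_fun h f
  rw [Derivation.commutator_apply] at this
  exact sub_eq_zero.mp this

/-- Iterated total derivative. -/
noncomputable abbrev DD (k : Type*) [CommRing k] {n : ℕ} (τ : Type*) (Λ : Fin n →₀ ℕ) :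
    MvPolynomial (τ × (Fin n →₀ ℕ)) k → MvPolynomial (τ × (Fin n →₀ ℕ)) k :=
  dIter (fun l => ⇑(totalDeriv k τ l)) Λ

theorem DD_succ (Λ : Fin n →₀ ℕ) (l : Fin n) (f : MvPolynomial (τ × (Fin n →₀ ℕ)) k) :
    DD k τ (Λ + Finsupp.single l 1) f = totalDeriv k τ l (DD k τ Λ f) :=
  dIter_succ _ (fun i j => totalDeriv_comm i j) Λ l f

theorem DD_zero (f : MvPolynomial (τ × (Fin n →₀ ℕ)) k) : DD k τ 0 f = f := dIter_zero _ f

theorem DD_add (Λ : Fin n →₀ ℕ) (f g : MvPolynomial (τ × (Fin n →₀ ℕ)) k) :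
    DD k τ Λ (f + g) = DD k τ Λ f + DD k τ Λ g := by
  induction Λ using mi_induction with
  | h0 => simp only [DD_zero]
  | hs Λ l ih => simp only [DD_succ, ih, map_add]

theorem DD_map_zero (Λ : Fin n →₀ ℕ) : DD k τ Λ 0 = 0 := by
  have := DD_add (k := k) (τ := τ) Λ 0 0
  simpa using this

theorem DD_comm (Λ : Fin n →₀ ℕ) (l : Fin n) (f : MvPolynomial (τ × (Fin n →₀ ℕ)) k) :
    DD k τ Λ (totalDeriv k τ l f) = totalDeriv k τ l (DD k τ Λ f) := by
  induction Λ using mi_induction with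
  | h0 => simp only [DD_zero]
  | hs Λ m ih => simp only [DD_succ, ih]; exact (totalDeriv_comm m l).eq _

theorem msize_succ (Λ : Fin n →₀ ℕ) (l : Fin n) :
    msize (Λ + Finsupp.single l 1) = msize Λ + 1 := by
  simp [msize, Finset.sum_add_distrib, Finsupp.single_apply]

theorem pderiv_totalDeriv_succ (j : τ) (Λ : Fin n →₀ ℕ) (l : Fin n)
    (f : MvPolynomial (τ × (Fin n →₀ ℕ)) k) :
    pderiv (j, Λ + Finsupp.single l 1) (totalDeriv k τ l f) =
      totalDeriv k τ l (pderiv (j, Λ + Finsupp.single l 1) f) + pderiv (j, Λ) f := by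
  classical
  have h : ⁅pderiv (R := k) (j, Λ + Finsupp.single l 1), totalDeriv k τ l⁆ = pderiv (j, Λ) := by
    apply MvPolynomial.derivation_ext
    rintro ⟨i, T⟩
    rw [Derivation.commutator_apply, totalDeriv_X, pderiv_X, pderiv_X, pderiv_X]
    simp only [Pi.single_apply, Prod.mk.injEq, add_left_inj]
    have : totalDeriv k τ l (if i = j ∧ T = Λ + Finsupp.single l 1 then 1 else 0) = 0 := by
      split_ifs <;> simp
    rw [this, sub_zero]
  have := DFunLike.congr_fun h f
  rw [Derivation.commutator_apply] at this
  rw [← this]; ring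

theorem pderiv_totalDeriv_zero (j : τ) (Λ : Fin n →₀ ℕ) (l : Fin n)
    (hΛ : ∀ T, Λ ≠ T + Finsupp.single l 1)
    (f : MvPolynomial (τ × (Fin n →₀ ℕ)) k) :
    pderiv (j, Λ) (totalDeriv k τ l f) = totalDeriv k τ l (pderiv (j, Λ) f) := by
  classical
  have h : ⁅pderiv (R := k) (j, Λ), totalDeriv k τ l⁆ = 0 := by
    apply MvPolynomial.derivation_ext
    rintro ⟨i, T⟩
    rw [Derivation.commutator_apply, totalDeriv_X, pderiv_X, pderiv_X]
    simp only [Pi.single_apply, Prod.mk.injEq, (hΛ T).symm, and_false, if_false]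
    have : totalDeriv k τ l (if i = j ∧ T = Λ then 1 else 0) = 0 := by
      split_ifs <;> simp
    rw [this]; simp
  have := DFunLike.congr_fun h f
  rw [Derivation.commutator_apply] at this
  exact sub_eq_zero.mp this

theorem pderiv_finite (j : τ) (f : MvPolynomial (τ × (Fin n →₀ ℕ)) k) :
    {Λ : Fin n →₀ ℕ | pderiv (j, Λ) f ≠ 0}.Finite := by
  classical
  refine (f.vars.image Prod.snd).finite_toSet.subset ?_
  intro Λ h
  simp only [Finset.coe_image, Set.mem_image, Finset.mem_coe]
  by_contra hc
  exact h (pderiv_eq_zero_of_notMem_vars fun hm => hc ⟨_, hm, rfl⟩)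

theorem EL_supp (j : τ) (F : MvPolynomial (τ × (Fin n →₀ ℕ)) k → MvPolynomial (τ × (Fin n →₀ ℕ)) k)
    (hF : F 0 = 0) (f : MvPolynomial (τ × (Fin n →₀ ℕ)) k) :
    (Function.support fun Λ : Fin n →₀ ℕ => (-1 : MvPolynomial (τ × (Fin n →₀ ℕ)) k) ^ msize Λ *
      DD k τ Λ (F (pderiv (j, Λ) f))).Finite := by
  refine (pderiv_finite j f).subset ?_
  intro Λ h h0
  exact h (by simp only [h0, hF, DD_map_zero, mul_zero])

theorem EL_add (j : τ) (f g : MvPolynomial (τ × (Fin n →₀ ℕ)) k) :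
    EL k τ j (f + g) = EL k τ j f + EL k τ j g := by
  unfold EL
  refine Eq.trans ?_ (finsum_add_distrib (EL_supp j id rfl f) (EL_supp j id rfl g))
  refine finsum_congr fun Λ => ?_
  change _ = (-1) ^ msize Λ * DD k τ Λ (pderiv (j, Λ) f) + (-1) ^ msize Λ * DD k τ Λ (pderiv (j, Λ) g)
  rw [map_add, ← mul_add, ← DD_add]

/-- Euler–Lagrange derivative as an additive map. -/
noncomputable def ELhom (k : Type*) [CommRing k] {n : ℕ} (τ : Type*) (j : τ) :
    MvPolynomial (τ × (Fin n →₀ ℕ)) k →+ MvPolynomial (τ × (Fin n →₀ ℕ)) k :=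
  AddMonoidHom.mk' (EL k τ j) (EL_add j)

theorem EL_totalDeriv (j : τ) (l : Fin n) (f : MvPolynomial (τ × (Fin n →₀ ℕ)) k) :
    EL k τ j (totalDeriv k τ l f) = 0 := by
  classical
  set h : (Fin n →₀ ℕ) → MvPolynomial (τ × (Fin n →₀ ℕ)) k := fun Λ =>
    (-1) ^ msize Λ * DD k τ Λ (totalDeriv k τ l (pderiv (j, Λ) f)) with hh
  have hfin : (Function.support h).Finite := EL_supp j _ (map_zero _) f
  set h' : (Fin n →₀ ℕ) → MvPolynomial (τ × (Fin n →₀ ℕ)) k := fun Λ =>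
    (-1) ^ msize Λ * DD k τ Λ (pderiv (j, Λ) (totalDeriv k τ l f)) - h Λ with hh'
  have hfin' : (Function.support h').Finite :=
    ((EL_supp j id rfl (totalDeriv k τ l f)).union hfin).subset (Function.support_sub _ _)
  have h1 : EL k τ j (totalDeriv k τ l f) = ∑ᶠ Λ, (h' Λ + h Λ) := by
    unfold EL
    refine finsum_congr fun Λ => ?_
    simp only [hh', sub_add_cancel]
  have hz : ∀ Λ, Λ ∉ Set.range (fun T : Fin n →₀ ℕ => T + Finsupp.single l 1) → h' Λ = 0 := by
    intro Λ hΛ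
    simp only [hh', hh]
    rw [pderiv_totalDeriv_zero j Λ l (fun T hT => hΛ ⟨T, hT.symm⟩), sub_self]
  have hs : ∀ T, h' (T + Finsupp.single l 1) = - h T := by
    intro T
    simp only [hh', hh]
    rw [pderiv_totalDeriv_succ, DD_add, msize_succ, DD_succ T l (pderiv (j, T) f), DD_comm T, pow_succ]
    ring
  have h2 : ∑ᶠ Λ, h' Λ = - ∑ᶠ Λ, h Λ := by
    rw [← finsum_neg_distrib]
    rw [← finsum_congr hs, ← finsum_mem_range (f := h') (add_left_injective (Finsupp.single l 1))]
    refine finsum_congr fun Λ => ?_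
    by_cases hm : Λ ∈ Set.range (fun T : Fin n →₀ ℕ => T + Finsupp.single l 1)
    · rw [finsum_eq_if, if_pos hm]
    · rw [finsum_eq_if, if_neg hm, hz Λ hm]
  rw [h1, finsum_add_distrib hfin' hfin, h2, neg_add_cancel]

theorem EL_totalDiv (j : τ) (f : MvPolynomial (τ × (Fin n →₀ ℕ)) k) (hf : IsTotalDiv k f) :
    EL k τ j f = 0 := by
  obtain ⟨σ, rfl⟩ := hf
  change ELhom k τ j _ = 0
  rw [map_sum]
  exact Finset.sum_eq_zero fun l _ => EL_totalDeriv j l _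

theorem mchoose_succ_left (T Λ : Fin n →₀ ℕ) (l : Fin n) :
    mchoose (T + Λ + Finsupp.single l 1) (T + Finsupp.single l 1) =
      mchoose (T + Λ) T + mchoose (T + Λ) (T + Finsupp.single l 1) := by
  unfold mchoose
  rw [← Finset.mul_prod_erase _ _ (Finset.mem_univ l), ← Finset.mul_prod_erase _ (fun i => ((T + Λ) i).choose (T i)) (Finset.mem_univ l),
    ← Finset.mul_prod_erase _ (fun i => ((T + Λ) i).choose ((T + Finsupp.single l 1 : Fin n →₀ ℕ) i)) (Finset.mem_univ l)]
  have e1 : ∀ i ∈ Finset.univ.erase l, ((T + Λ + Finsupp.single l 1 : Fin n →₀ ℕ) i).choose ((T + Finsupp.single l 1 : Fin n →₀ ℕ) i) = ((T + Λ) i).choose (T i) := by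
    intro i hi
    have : l ≠ i := (Finset.ne_of_mem_erase hi).symm
    simp [Finsupp.single_apply, this]
  have e2 : ∀ i ∈ Finset.univ.erase l, ((T + Λ) i).choose ((T + Finsupp.single l 1 : Fin n →₀ ℕ) i) = ((T + Λ) i).choose (T i) := by
    intro i hi
    have : l ≠ i := (Finset.ne_of_mem_erase hi).symm
    simp [Finsupp.single_apply, this]
  rw [Finset.prod_congr rfl e1, Finset.prod_congr rfl e2, ← add_mul]
  congr 1
  simp [Nat.choose_succ_succ]

theorem mchoose_zero_left (Ξ T : Fin n →₀ ℕ) (l : Fin n) (h : T l = 0) :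
    mchoose (Ξ + Finsupp.single l 1) T = mchoose Ξ T := by
  unfold mchoose
  refine Finset.prod_congr rfl fun i _ => ?_
  by_cases hi : l = i
  · subst hi; simp [h]
  · simp [Finsupp.single_apply, hi]

theorem mchoose_gt (Ξ T : Fin n →₀ ℕ) (l : Fin n) (h : Ξ l < T l) : mchoose Ξ T = 0 :=
  Finset.prod_eq_zero (Finset.mem_univ l) (Nat.choose_eq_zero_of_lt h)

theorem sub_add_single (T : Fin n →₀ ℕ) (l : Fin n) (h : T l ≠ 0) :
    T - Finsupp.single l 1 + Finsupp.single l 1 = T := by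
  apply tsub_add_cancel_of_le
  simpa [Nat.one_le_iff_ne_zero] using h

theorem sum_antidiag_succ {A : Type*} [CommRing A] (G : (Fin n →₀ ℕ) → (Fin n →₀ ℕ) → A)
    (Ξ : Fin n →₀ ℕ) (l : Fin n) :
    ∑ q ∈ Finset.HasAntidiagonal.antidiagonal (Ξ + Finsupp.single l 1),
      (mchoose (Ξ + Finsupp.single l 1) q.1 : A) * G q.1 q.2 =
    ∑ q ∈ Finset.HasAntidiagonal.antidiagonal Ξ, (mchoose Ξ q.1 : A) *
      (G (q.1 + Finsupp.single l 1) q.2 + G q.1 (q.2 + Finsupp.single l 1)) := by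
  have hp : ∀ q ∈ Finset.HasAntidiagonal.antidiagonal (Ξ + Finsupp.single l 1),
      (mchoose (Ξ + Finsupp.single l 1) q.1 : A) * G q.1 q.2 =
      (if q.1 l ≠ 0 then (mchoose Ξ (q.1 - Finsupp.single l 1) : A) * G q.1 q.2 else 0) +
      (if q.2 l ≠ 0 then (mchoose Ξ q.1 : A) * G q.1 q.2 else 0) := by
    rintro ⟨T, Λ⟩ hq
    rw [Finset.HasAntidiagonal.mem_antidiagonal] at hq
    have hql : T l + Λ l = Ξ l + 1 := by
      have := DFunLike.congr_fun hq l
      simpa using this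
    have e2 : (if Λ l ≠ 0 then (mchoose Ξ T : A) * G T Λ else 0) = (mchoose Ξ T : A) * G T Λ := by
      split_ifs with h
      · rfl
      · rw [mchoose_gt Ξ T l (by omega)]; simp
    simp only [e2]
    by_cases h : T l = 0
    · simp [h, mchoose_zero_left]
    · simp only [ne_eq, h, not_false_eq_true, if_true]
      obtain ⟨T', rfl⟩ : ∃ T', T = T' + Finsupp.single l 1 := ⟨_, (sub_add_single T l h).symm⟩
      have hX : Ξ = T' + Λ := by
        apply add_right_cancel (b := Finsupp.single l 1)
        rw [← hq]; simp only; abel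
      rw [hX, mchoose_succ_left]
      simp only [add_tsub_cancel_right]
      push_cast; ring
  rw [Finset.sum_congr rfl hp, Finset.sum_add_distrib, ← Finset.sum_filter, ← Finset.sum_filter]
  simp only [mul_add]
  rw [Finset.sum_add_distrib]
  congr 1
  · refine Finset.sum_nbij' (fun q => (q.1 - Finsupp.single l 1, q.2))
      (fun q => (q.1 + Finsupp.single l 1, q.2)) ?_ ?_ ?_ ?_ ?_
    · rintro ⟨T, Λ⟩ hq
      simp only [Finset.mem_filter, Finset.HasAntidiagonal.mem_antidiagonal] at hq ⊢
      apply add_right_cancel (b := Finsupp.single l 1)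
      rw [add_right_comm, sub_add_single T l hq.2, hq.1]
    · rintro ⟨T, Λ⟩ hq
      simp only [Finset.mem_filter, Finset.HasAntidiagonal.mem_antidiagonal] at hq ⊢
      exact ⟨by rw [add_right_comm, hq], by simp⟩
    · rintro ⟨T, Λ⟩ hq
      simp only [Finset.mem_filter] at hq
      simp only [sub_add_single T l hq.2]
    · rintro ⟨T, Λ⟩ hq
      simp
    · rintro ⟨T, Λ⟩ hq
      simp only [Finset.mem_filter] at hq
      simp only [sub_add_single T l hq.2]
  · refine Finset.sum_nbij' (fun q => (q.1, q.2 - Finsupp.single l 1))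
      (fun q => (q.1, q.2 + Finsupp.single l 1)) ?_ ?_ ?_ ?_ ?_
    · rintro ⟨T, Λ⟩ hq
      simp only [Finset.mem_filter, Finset.HasAntidiagonal.mem_antidiagonal] at hq ⊢
      apply add_right_cancel (b := Finsupp.single l 1)
      rw [add_assoc, sub_add_single Λ l hq.2, hq.1]
    · rintro ⟨T, Λ⟩ hq
      simp only [Finset.mem_filter, Finset.HasAntidiagonal.mem_antidiagonal] at hq ⊢
      exact ⟨by rw [← add_assoc, hq], by simp⟩
    · rintro ⟨T, Λ⟩ hq
      simp only [Finset.mem_filter] at hq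
      simp only [sub_add_single Λ l hq.2]
    · rintro ⟨T, Λ⟩ hq
      simp
    · rintro ⟨T, Λ⟩ hq
      simp only [Finset.mem_filter] at hq
      simp only [sub_add_single Λ l hq.2]

theorem DD_mul (Ξ : Fin n →₀ ℕ) (a b : MvPolynomial (τ × (Fin n →₀ ℕ)) k) :
    DD k τ Ξ (a * b) = ∑ q ∈ Finset.HasAntidiagonal.antidiagonal Ξ,
      (mchoose Ξ q.1 : MvPolynomial (τ × (Fin n →₀ ℕ)) k) * (DD k τ q.1 a * DD k τ q.2 b) := by
  induction Ξ using mi_induction with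
  | h0 => simp [DD_zero, mchoose]
  | hs Ξ l ih =>
    rw [sum_antidiag_succ (fun T Λ => DD k τ T a * DD k τ Λ b), DD_succ, ih, map_sum]
    refine Finset.sum_congr rfl fun q _ => ?_
    rw [Derivation.leibniz, Derivation.map_natCast, Derivation.leibniz, DD_succ, DD_succ]
    simp only [smul_eq_mul]
    ring

end

section
variable {k : Type*} [CommRing k] {n : ℕ} {ι ρ : Type*}

theorem fieldEmb_inj : Function.Injective (fieldEmb (n := n) k ι ρ) := by
  apply MvPolynomial.rename_injective
  rintro ⟨a, b⟩ ⟨c, d⟩ h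
  simpa using h

theorem fieldEmb_totalDeriv (l : Fin n) (f : MvPolynomial (ι × (Fin n →₀ ℕ)) k) :
    fieldEmb k ι ρ (totalDeriv k ι l f) = totalDeriv k (ι ⊕ ρ) l (fieldEmb k ι ρ f) := by
  induction f using MvPolynomial.induction_on with
  | C a =>
    rw [← MvPolynomial.algebraMap_eq, Derivation.map_algebraMap, AlgHom.commutes,
      Derivation.map_algebraMap, map_zero]
  | add p q hp hq => simp only [map_add, hp, hq]
  | mul_X p x hp =>
    simp only [Derivation.leibniz, map_mul, map_add, hp, totalDeriv_X, smul_eq_mul]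
    simp only [fieldEmb, rename_X, totalDeriv_X]

theorem fieldEmb_DD (Λ : Fin n →₀ ℕ) (f : MvPolynomial (ι × (Fin n →₀ ℕ)) k) :
    fieldEmb k ι ρ (DD k ι Λ f) = DD k (ι ⊕ ρ) Λ (fieldEmb k ι ρ f) := by
  induction Λ using mi_induction with
  | h0 => simp only [DD_zero]
  | hs Λ l ih => simp only [DD_succ, fieldEmb_totalDeriv, ih]

theorem pderiv_fieldEmb (r : ρ) (Λ : Fin n →₀ ℕ) (f : MvPolynomial (ι × (Fin n →₀ ℕ)) k) :
    pderiv (Sum.inr r, Λ) (fieldEmb k ι ρ f) = 0 := by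
  induction f using MvPolynomial.induction_on with
  | C a => rw [← MvPolynomial.algebraMap_eq, AlgHom.commutes, Derivation.map_algebraMap]
  | add p q hp hq => simp only [map_add, hp, hq, add_zero]
  | mul_X p x hp =>
    rw [map_mul, Derivation.leibniz, hp]
    simp only [fieldEmb, rename_X]
    rw [pderiv_X_of_ne (by simp)]; simp

open Classical in
theorem EL_term (r s : ρ) (Ξ : Fin n →₀ ℕ) (a b : MvPolynomial (ι × (Fin n →₀ ℕ)) k) :
    EL k (ι ⊕ ρ) (Sum.inr r) (fieldEmb k ι ρ a * X ((Sum.inr s : ι ⊕ ρ), Ξ) * fieldEmb k ι ρ b) =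
      fieldEmb k ι ρ (if s = r then (-1) ^ msize Ξ * DD k ι Ξ (a * b) else 0) := by
  have hd : ∀ Λ, pderiv (Sum.inr r, Λ)
      (fieldEmb k ι ρ a * X ((Sum.inr s : ι ⊕ ρ), Ξ) * fieldEmb k ι ρ b) =
      if s = r ∧ Ξ = Λ then fieldEmb k ι ρ (a * b) else 0 := by
    intro Λ
    rw [Derivation.leibniz, Derivation.leibniz, pderiv_fieldEmb, pderiv_fieldEmb, pderiv_X]
    simp only [Pi.single_apply, Prod.mk.injEq, Sum.inr.injEq, smul_eq_mul, map_mul]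
    split_ifs <;> ring
  unfold EL
  simp only [hd]
  rw [finsum_eq_single _ Ξ]
  · by_cases h : s = r
    · simp only [h, and_self, if_true, map_mul (fieldEmb k ι ρ) ((-1) ^ _), map_pow, map_neg, map_one]
      rw [fieldEmb_DD]
    · simp only [h, false_and, if_false, map_zero]
      exact mul_eq_zero_of_right _ (DD_map_zero _)
  · intro Λ hΛ
    simp only [hΛ.symm, and_false, if_false]
    exact mul_eq_zero_of_right _ (DD_map_zero _)

end

/-- Noether's second theorem, direct part (Theorem 0510): if `υ` is a gauge symmetry
of `L`, then the Noether identity `∑_{i,Λ} Δ^{i,Λ}_r d_Λ (E_i(L)) = 0` holds, where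
`Δ^{i,Λ}_r = ∑_T (-1)^{|T+Λ|} C(T+Λ,T) d_T (υ^{i,T+Λ}_r)`. -/
theorem noether_second_direct (k : Type*) [CommRing k] (n : ℕ) (hn : 1 ≤ n)
    (ι ρ : Type*) (L : MvPolynomial (ι × (Fin n →₀ ℕ)) k)
    (υ : ι → ρ → (Fin n →₀ ℕ) → MvPolynomial (ι × (Fin n →₀ ℕ)) k)
    (hυ : (Function.support fun p : ι × ρ × (Fin n →₀ ℕ) => υ p.1 p.2.1 p.2.2).Finite)
    (hsym : IsGaugeSymmetry k ι ρ υ L) :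
    ∀ r : ρ,
      ∑ᶠ p : ι × (Fin n →₀ ℕ),
        (∑ᶠ T : Fin n →₀ ℕ,
            (-1 : MvPolynomial (ι × (Fin n →₀ ℕ)) k) ^ msize (T + p.2) *
              (mchoose (T + p.2) T : MvPolynomial (ι × (Fin n →₀ ℕ)) k) *
                dIter (fun l => ⇑(totalDeriv k ι l)) T (υ p.1 r (T + p.2))) *
          dIter (fun l => ⇑(totalDeriv k ι l)) p.2 (EL k ι p.1 L) = 0 := by
  classical
  intro r
  set S := hυ.toFinset with hS
  have hS' : ∀ i s Ξ, υ i s Ξ ≠ 0 → (i, s, Ξ) ∈ S := by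
    intro i s Ξ h
    rw [hS, Set.Finite.mem_toFinset]
    exact h
  have h1 := EL_totalDiv (Sum.inr r) _ hsym
  rw [finsum_eq_sum_of_support_subset (s := S)] at h1
  swap
  · rintro ⟨i, s, Ξ⟩ h
    apply hS'
    intro h0
    apply h
    simp only [h0, map_zero, zero_mul]
  change ELhom k (ι ⊕ ρ) (Sum.inr r) _ = 0 at h1
  rw [map_sum] at h1
  have h2 : ∑ p ∈ S, (if p.2.1 = r then (-1) ^ msize p.2.2 *
      DD k ι p.2.2 (υ p.1 p.2.1 p.2.2 * EL k ι p.1 L) else 0) = 0 := by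
    apply fieldEmb_inj (k := k) (ι := ι) (ρ := ρ)
    rw [map_sum, map_zero, ← h1]
    exact Finset.sum_congr rfl fun p _ => (EL_term r p.2.1 p.2.2 _ _).symm
  rw [← Finset.sum_filter] at h2
  set g : (ι × (Fin n →₀ ℕ)) × (Fin n →₀ ℕ) → MvPolynomial (ι × (Fin n →₀ ℕ)) k := fun x =>
    (-1) ^ msize (x.2 + x.1.2) * (mchoose (x.2 + x.1.2) x.2 : MvPolynomial (ι × (Fin n →₀ ℕ)) k) *
      DD k ι x.2 (υ x.1.1 r (x.2 + x.1.2)) * DD k ι x.1.2 (EL k ι x.1.1 L) with hg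
  set F : Finset ((ι × (Fin n →₀ ℕ)) × (Fin n →₀ ℕ)) :=
    ((S.filter fun p => p.2.1 = r).sigma fun p => Finset.HasAntidiagonal.antidiagonal p.2.2).image
      (fun x => ((x.1.1, x.2.2), x.2.1)) with hF
  have hυF : ∀ i Λ T, υ i r (T + Λ) ≠ 0 → ((i, Λ), T) ∈ F := by
    intro i Λ T h
    rw [hF, Finset.mem_image]
    refine ⟨⟨(i, r, T + Λ), (T, Λ)⟩, ?_, rfl⟩
    simp [hS' _ _ _ h]
  have hsupp : Function.support g ⊆ F := by
    rintro ⟨⟨i, Λ⟩, T⟩ h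
    apply hυF
    intro h0
    apply h
    simp only [hg, h0, DD_map_zero, mul_zero, zero_mul]
  have h3 : ∑ᶠ x, g x = 0 := by
    rw [finsum_eq_sum_of_support_subset _ hsupp, hF, Finset.sum_image, Finset.sum_sigma, ← h2]
    · refine Finset.sum_congr rfl ?_
      rintro ⟨i, s, Ξ⟩ hp
      obtain rfl : s = r := (Finset.mem_filter.mp hp).2
      rw [DD_mul, Finset.mul_sum]
      refine Finset.sum_congr rfl ?_
      rintro ⟨T, Λ⟩ hq
      obtain rfl : T + Λ = Ξ := Finset.HasAntidiagonal.mem_antidiagonal.mp hq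
      simp only [hg]
      ring
    · rintro ⟨⟨i, s, Ξ⟩, ⟨T, Λ⟩⟩ hx ⟨⟨i', s', Ξ'⟩, ⟨T', Λ'⟩⟩ hx' h
      simp only [Finset.coe_sigma, Set.mem_sigma_iff, Finset.mem_coe, Finset.mem_filter,
        Finset.HasAntidiagonal.mem_antidiagonal] at hx hx'
      simp only [Prod.mk.injEq] at h
      obtain ⟨⟨rfl, rfl⟩, rfl⟩ := h
      obtain ⟨⟨_, rfl⟩, rfl⟩ := hx
      obtain ⟨⟨_, rfl⟩, rfl⟩ := hx'
      rfl
  rw [finsum_curry g (F.finite_toSet.subset hsupp)] at h3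
  rw [← h3]
  refine finsum_congr ?_
  rintro ⟨i, Λ⟩
  rw [finsum_mul']
  refine (F.image Prod.snd).finite_toSet.subset ?_
  intro T h
  rw [Finset.mem_coe, Finset.mem_image]
  refine ⟨((i, Λ), T), hυF _ _ _ ?_, rfl⟩
  intro h0
  apply h
  simp only [h0]
  exact mul_eq_zero_of_right _ (DD_map_zero _)
end

section
/- Example 0655 (first-jet-order gauge symmetries): let L ∈ R and suppose (υ^i_r)_{i∈ι,r∈ρ} and (υ^{i,μ}_r)_{i∈ι,r∈ρ,μ∈Fin n} are finitely supported families of elements of R such that Σ_{i,r} (ι̂(υ^i_r) · ξ^r_0 + Σ_μ ι̂(υ^{i,μ}_r) · ξ^r_{e_μ}) · ι̂(E_i(L)) is a total divergence in R'. Then for every r ∈ ρ the first-order Noether identity holds in R: Σ_i ( υ^i_r · E_i(L) − Σ_μ d_μ( υ^{i,μ}_r · E_i(L) ) ) = 0. -/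
open MvPolynomial in
theorem aux_td_X (k : Type*) [CommRing k] {n : ℕ} (τ : Type*) (l : Fin n)
    (p : τ × (Fin n →₀ ℕ)) :
    totalDeriv k τ l (X p) = X (p.1, p.2 + Finsupp.single l 1) := by
  simp [totalDeriv, mkDerivation_X]

open MvPolynomial in
theorem aux_td_comm (k : Type*) [CommRing k] {n : ℕ} (τ : Type*) (l m : Fin n) :
    Commute (totalDeriv k τ l).toLinearMap (totalDeriv k τ m).toLinearMap := by
  have h : ⁅totalDeriv k τ l, totalDeriv k τ m⁆ = 0 := by
    apply derivation_ext
    intro p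
    simp [Derivation.commutator_apply, aux_td_X, add_right_comm]
  apply LinearMap.ext
  intro f
  have := congrArg (fun D => D f) h
  simpa [Derivation.commutator_apply, sub_eq_zero] using this

open MvPolynomial in
theorem aux_pd_succ (k : Type*) [CommRing k] {n : ℕ} (τ : Type*) (l : Fin n) (j : τ)
    (Λ : Fin n →₀ ℕ) (f : MvPolynomial (τ × (Fin n →₀ ℕ)) k) :
    pderiv (j, Λ + Finsupp.single l 1) (totalDeriv k τ l f)
      = totalDeriv k τ l (pderiv (j, Λ + Finsupp.single l 1) f) + pderiv (j, Λ) f := by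
  classical
  have h : ⁅(pderiv (j, Λ + Finsupp.single l 1) : Derivation k _ _), totalDeriv k τ l⁆
      = pderiv (j, Λ) := by
    apply derivation_ext
    rintro ⟨j', Λ'⟩
    rw [Derivation.commutator_apply, aux_td_X, pderiv_X, pderiv_X, pderiv_X]
    simp only [Pi.single_apply, Prod.mk.injEq, add_left_inj]
    have : ∀ P : Prop, ∀ [Decidable P], totalDeriv k τ l (if P then 1 else 0) = 0 := by
      intro P _; split_ifs <;> simp
    rw [this, sub_zero]
  have := congrArg (fun D => D f) h
  simp only [Derivation.commutator_apply] at this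
  rw [← this]; ring

open MvPolynomial in
theorem aux_pd_zero (k : Type*) [CommRing k] {n : ℕ} (τ : Type*) (l : Fin n) (j : τ)
    (Λ : Fin n →₀ ℕ) (hΛ : Λ l = 0) (f : MvPolynomial (τ × (Fin n →₀ ℕ)) k) :
    pderiv (j, Λ) (totalDeriv k τ l f) = totalDeriv k τ l (pderiv (j, Λ) f) := by
  classical
  have h : ⁅(pderiv (j, Λ) : Derivation k _ _), totalDeriv k τ l⁆ = 0 := by
    apply derivation_ext
    rintro ⟨j', Λ'⟩
    rw [Derivation.commutator_apply, aux_td_X, pderiv_X, pderiv_X]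
    simp only [Pi.single_apply, Prod.mk.injEq]
    have : ∀ P : Prop, ∀ [Decidable P], totalDeriv k τ l (if P then 1 else 0) = 0 := by
      intro P _; split_ifs <;> simp
    rw [this, sub_zero, if_neg]
    · simp
    · rintro ⟨-, rfl⟩
      simp at hΛ
  have := congrArg (fun D => D f) h
  simpa [Derivation.commutator_apply, sub_eq_zero] using this

theorem aux_pw (k : Type*) [CommRing k] {n : ℕ} (τ : Type*) (Λ Λ' : Fin n →₀ ℕ) (l m : Fin n) :
    Commute ((-(totalDeriv k τ l).toLinearMap) ^ Λ l)
      ((-(totalDeriv k τ m).toLinearMap) ^ Λ' m) :=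
  ((aux_td_comm k τ l m).neg_left.neg_right).pow_pow _ _

theorem aux_pairwise (k : Type*) [CommRing k] {n : ℕ} (τ : Type*) (Λ : Fin n →₀ ℕ)
    (s : Finset (Fin n)) :
    (s : Set (Fin n)).Pairwise (Function.onFun Commute
      fun l => (-(totalDeriv k τ l).toLinearMap) ^ Λ l) :=
  fun l _ m _ _ => aux_pw k τ Λ Λ l m

/-- Iterated, signed total derivative as a linear map. -/
noncomputable def auxD (k : Type*) [CommRing k] {n : ℕ} (τ : Type*) (Λ : Fin n →₀ ℕ) :
    Module.End k (MvPolynomial (τ × (Fin n →₀ ℕ)) k) :=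
  Finset.univ.noncommProd (fun l => (-(totalDeriv k τ l).toLinearMap) ^ Λ l)
    (aux_pairwise k τ Λ _)

theorem auxD_zero (k : Type*) [CommRing k] {n : ℕ} (τ : Type*) :
    auxD k τ (0 : Fin n →₀ ℕ) = 1 := by
  unfold auxD
  rw [Finset.noncommProd_eq_pow_card _ _ _ 1] <;> simp

theorem auxD_single (k : Type*) [CommRing k] {n : ℕ} (τ : Type*) (l : Fin n) :
    auxD k τ (Finsupp.single l 1 : Fin n →₀ ℕ) = -(totalDeriv k τ l).toLinearMap := by
  classical
  have := Finset.noncommProd_insert_of_notMem (Finset.univ.erase l) l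
    (fun m => (-(totalDeriv k τ m).toLinearMap) ^ (Finsupp.single l 1 : Fin n →₀ ℕ) m)
    (fun l _ m _ _ => ((aux_td_comm k τ l m).neg_left.neg_right).pow_pow _ _) (by simp)
  simp only [Finset.insert_erase (Finset.mem_univ l)] at this
  unfold auxD
  rw [this, Finset.noncommProd_eq_pow_card _ _ _ 1]
  · simp
  · intro m hm
    rw [Finsupp.single_eq_of_ne (by simpa using hm)]
    simp

theorem auxD_add (k : Type*) [CommRing k] {n : ℕ} (τ : Type*) (Λ Λ' : Fin n →₀ ℕ) :
    auxD k τ (Λ + Λ') = auxD k τ Λ * auxD k τ Λ' := by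
  unfold auxD
  rw [← Finset.noncommProd_mul_distrib _ _ (aux_pairwise k τ Λ _) (aux_pairwise k τ Λ' _)
    (fun l _ m _ _ => aux_pw k τ Λ' Λ l m)]
  apply Finset.noncommProd_congr rfl
  intro m _
  simp [pow_add]

open MvPolynomial in
theorem aux_fin (k : Type*) [CommRing k] {n : ℕ} (τ : Type*) (j : τ)
    (g : (Fin n →₀ ℕ) → Module.End k (MvPolynomial (τ × (Fin n →₀ ℕ)) k))
    (f : MvPolynomial (τ × (Fin n →₀ ℕ)) k) :
    (Function.support fun Λ => g Λ (pderiv (j, Λ) f)).Finite := by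
  classical
  apply (f.vars.image Prod.snd).finite_toSet.subset
  intro Λ h
  by_contra hc
  apply h
  have : (j, Λ) ∉ f.vars := fun h' => hc (by
    simp only [Finset.coe_image, Set.mem_image]
    exact ⟨_, h', rfl⟩)
  simp [pderiv_eq_zero_of_notMem_vars this]

open MvPolynomial in
/-- The Euler operator, as an additive map. -/
noncomputable def auxE (k : Type*) [CommRing k] {n : ℕ} (τ : Type*) (j : τ) :
    MvPolynomial (τ × (Fin n →₀ ℕ)) k →+ MvPolynomial (τ × (Fin n →₀ ℕ)) k where
  toFun f := ∑ᶠ Λ, auxD k τ Λ (pderiv (j, Λ) f)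
  map_zero' := by simp
  map_add' f g := by
    rw [← finsum_add_distrib (aux_fin k τ j _ f) (aux_fin k τ j _ g)]
    simp

open MvPolynomial in
theorem auxE_td (k : Type*) [CommRing k] {n : ℕ} (τ : Type*) (j : τ) (l : Fin n)
    (f : MvPolynomial (τ × (Fin n →₀ ℕ)) k) : auxE k τ j (totalDeriv k τ l f) = 0 := by
  classical
  let G : (Fin n →₀ ℕ) → MvPolynomial (τ × (Fin n →₀ ℕ)) k := fun Λ =>
    if Λ l = 0 then 0 else auxD k τ Λ (pderiv (j, Λ - Finsupp.single l 1) f)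
  let H : (Fin n →₀ ℕ) → MvPolynomial (τ × (Fin n →₀ ℕ)) k := fun Λ =>
    auxD k τ (Λ + Finsupp.single l 1) (pderiv (j, Λ) f)
  have hinj : Function.Injective (fun Λ : Fin n →₀ ℕ => Λ + Finsupp.single l 1) :=
    add_left_injective _
  have hGH : ∀ Λ, G (Λ + Finsupp.single l 1) = H Λ := by
    intro Λ; simp [G, H]
  have hdec : ∀ Λ : Fin n →₀ ℕ, Λ l ≠ 0 → ∃ Λ', Λ' + Finsupp.single l 1 = Λ := by
    intro Λ h
    refine ⟨Λ - Finsupp.single l 1, tsub_add_cancel_of_le ?_⟩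
    rw [Finsupp.single_le_iff]; omega
  have hsupp : Function.support G ⊆ Set.range (fun Λ : Fin n →₀ ℕ => Λ + Finsupp.single l 1) := by
    intro Λ h
    apply hdec
    intro h0
    exact h (by simp [G, h0])
  have hHfin : (Function.support H).Finite :=
    aux_fin k τ j (fun Λ => auxD k τ (Λ + Finsupp.single l 1)) f
  have hGfin : (Function.support G).Finite := by
    apply (hHfin.image (fun Λ : Fin n →₀ ℕ => Λ + Finsupp.single l 1)).subset
    intro Λ h
    obtain ⟨Λ', rfl⟩ := hsupp h
    refine ⟨Λ', ?_, rfl⟩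
    rw [Function.mem_support, ← hGH]; exact h
  have hsum : ∑ᶠ Λ, G Λ = ∑ᶠ Λ, H Λ := by
    have h1 := finsum_mem_range (f := G) hinj
    rw [finsum_mem_def, Set.indicator_eq_self.2 hsupp] at h1
    rw [h1]
    exact finsum_congr hGH
  have hterm : ∀ Λ, auxD k τ Λ (pderiv (j, Λ) (totalDeriv k τ l f)) = - H Λ + G Λ := by
    intro Λ
    have hH : H Λ = - auxD k τ Λ (totalDeriv k τ l (pderiv (j, Λ) f)) := by
      simp [H, auxD_add, auxD_single]
    rw [hH, neg_neg]
    by_cases h : Λ l = 0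
    · rw [aux_pd_zero k τ l j Λ h]; simp [G, h]
    · obtain ⟨Λ', rfl⟩ := hdec Λ h
      rw [aux_pd_succ, map_add]; simp [G]
  change ∑ᶠ Λ, auxD k τ Λ (pderiv (j, Λ) (totalDeriv k τ l f)) = 0
  rw [finsum_congr hterm, finsum_add_distrib (by
      change (Function.support fun x => -H x).Finite
      rwa [Function.support_fun_neg]) hGfin,
    finsum_neg_distrib, hsum, neg_add_cancel]

open MvPolynomial in
theorem aux_emb_td (k : Type*) [CommRing k] {n : ℕ} (ι ρ : Type*) (l : Fin n)
    (f : MvPolynomial (ι × (Fin n →₀ ℕ)) k) :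
    totalDeriv k (ι ⊕ ρ) l (fieldEmb k ι ρ f) = fieldEmb k ι ρ (totalDeriv k ι l f) := by
  induction f using MvPolynomial.induction_on with
  | C a => simp [fieldEmb]
  | add p q hp hq => simp [hp, hq]
  | mul_X p i hp =>
    have : totalDeriv k (ι ⊕ ρ) l (fieldEmb k ι ρ (X i)) =
        fieldEmb k ι ρ (totalDeriv k ι l (X i)) := by
      simp [fieldEmb, aux_td_X]
    rw [map_mul, Derivation.leibniz, Derivation.leibniz, hp, this]
    simp

open MvPolynomial in
theorem aux_emb_pd (k : Type*) [CommRing k] {n : ℕ} (ι ρ : Type*) (r : ρ) (Λ : Fin n →₀ ℕ)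
    (f : MvPolynomial (ι × (Fin n →₀ ℕ)) k) :
    pderiv ((Sum.inr r : ι ⊕ ρ), Λ) (fieldEmb k ι ρ f) = 0 := by
  classical
  apply pderiv_eq_zero_of_notMem_vars
  intro h
  have := vars_rename _ _ h
  simp at this

open MvPolynomial in
theorem auxE_lin (k : Type*) [CommRing k] {n : ℕ} (ι ρ : Type*) [DecidableEq ρ] (r r' : ρ)
    (Λ : Fin n →₀ ℕ) (f : MvPolynomial (ι × (Fin n →₀ ℕ)) k) :
    auxE k (ι ⊕ ρ) (Sum.inr r) (fieldEmb k ι ρ f * X ((Sum.inr r' : ι ⊕ ρ), Λ))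
      = if r' = r then auxD k (ι ⊕ ρ) Λ (fieldEmb k ι ρ f) else 0 := by
  classical
  change ∑ᶠ Λ', auxD k (ι ⊕ ρ) Λ' (pderiv (Sum.inr r, Λ') _) = _
  rw [finsum_eq_single _ Λ]
  · rw [Derivation.leibniz, aux_emb_pd, pderiv_X]
    by_cases h : r' = r
    · subst h; simp
    · simp [Pi.single_apply, h, Ne.symm h]
  · intro Λ' h
    rw [Derivation.leibniz, aux_emb_pd, pderiv_X]
    simp [Pi.single_apply, h, Ne.symm h]

/-- Example 0655 (first-jet-order gauge symmetries): if
`∑_{i,r} (ι̂(υ^i_r) ξ^r_0 + ∑_μ ι̂(υ^{i,μ}_r) ξ^r_{e_μ}) ι̂(E_i(L))` is a total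
divergence, then for every `r` the first-order Noether identity
`∑_i (υ^i_r E_i(L) - ∑_μ d_μ (υ^{i,μ}_r E_i(L))) = 0` holds. -/
theorem first_order_noether_identity (k : Type*) [CommRing k] (n : ℕ) (hn : 1 ≤ n)
    (ι ρ : Type*) (L : MvPolynomial (ι × (Fin n →₀ ℕ)) k)
    (υ0 : ι → ρ → MvPolynomial (ι × (Fin n →₀ ℕ)) k)
    (υ1 : ι → ρ → Fin n → MvPolynomial (ι × (Fin n →₀ ℕ)) k)
    (hυ0 : (Function.support fun p : ι × ρ => υ0 p.1 p.2).Finite)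
    (hυ1 : (Function.support fun p : ι × ρ × Fin n => υ1 p.1 p.2.1 p.2.2).Finite)
    (hsym : IsTotalDiv k (∑ᶠ p : ι × ρ,
      (fieldEmb k ι ρ (υ0 p.1 p.2) *
          MvPolynomial.X ((Sum.inr p.2 : ι ⊕ ρ), (0 : Fin n →₀ ℕ))
        + ∑ μ, fieldEmb k ι ρ (υ1 p.1 p.2 μ) *
            MvPolynomial.X ((Sum.inr p.2 : ι ⊕ ρ), Finsupp.single μ 1)) *
        fieldEmb k ι ρ (EL k ι p.1 L))) :
    ∀ r : ρ,
      ∑ᶠ i : ι, (υ0 i r * EL k ι i L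
        - ∑ μ, totalDeriv k ι μ (υ1 i r μ * EL k ι i L)) = 0 := by
  classical
  intro r
  obtain ⟨σ, hσ⟩ := hsym
  have hE : auxE k (ι ⊕ ρ) (Sum.inr r) (∑ l, totalDeriv k (ι ⊕ ρ) l (σ l)) = 0 := by
    rw [map_sum]
    exact Finset.sum_eq_zero fun l _ => auxE_td k (ι ⊕ ρ) _ l _
  rw [← hσ] at hE
  let S : Finset (ι × ρ) := hυ0.toFinset ∪ hυ1.toFinset.image (fun p => (p.1, p.2.1))
  have hS : ∀ i r, (i, r) ∉ S → υ0 i r = 0 ∧ ∀ μ, υ1 i r μ = 0 := by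
    intro i r h
    simp only [S, Finset.mem_union, not_or] at h
    refine ⟨?_, fun μ => ?_⟩
    · by_contra hc
      exact h.1 (by simpa using hc)
    · by_contra hc
      exact h.2 (Finset.mem_image.2 ⟨(i, r, μ), by simpa using hc, rfl⟩)
  let A : Finset ι := S.image Prod.fst
  let B : Finset ρ := insert r (S.image Prod.snd)
  have hAB : ∀ i r', (i, r') ∉ A ×ˢ B → υ0 i r' = 0 ∧ ∀ μ, υ1 i r' μ = 0 := by
    intro i r' h
    apply hS
    intro h'
    exact h (Finset.mem_product.2 ⟨Finset.mem_image_of_mem _ h',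
      Finset.mem_insert_of_mem (Finset.mem_image_of_mem _ h')⟩)
  have hA : ∀ i, i ∉ A → υ0 i r = 0 ∧ ∀ μ, υ1 i r μ = 0 := by
    intro i h
    apply hAB
    intro h'
    exact h (Finset.mem_product.1 h').1
  rw [finsum_eq_sum_of_support_subset (s := A ×ˢ B), map_sum, Finset.sum_product] at hE
  · rw [finsum_eq_sum_of_support_subset (s := A)]
    · have hinj : Function.Injective (fieldEmb (n := n) k ι ρ) := by
        apply MvPolynomial.rename_injective
        rintro ⟨a, b⟩ ⟨c, d⟩ h
        simpa using h
      apply hinj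
      rw [map_zero, ← hE, map_sum]
      apply Finset.sum_congr rfl
      intro i _
      have key : ∀ r', auxE k (ι ⊕ ρ) (Sum.inr r) ((fieldEmb k ι ρ (υ0 i r') *
          MvPolynomial.X ((Sum.inr r' : ι ⊕ ρ), (0 : Fin n →₀ ℕ))
        + ∑ μ, fieldEmb k ι ρ (υ1 i r' μ) *
            MvPolynomial.X ((Sum.inr r' : ι ⊕ ρ), Finsupp.single μ 1)) *
        fieldEmb k ι ρ (EL k ι i L)) = if r' = r then fieldEmb k ι ρ (υ0 i r * EL k ι i L
        - ∑ μ, totalDeriv k ι μ (υ1 i r μ * EL k ι i L)) else 0 := by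
        intro r'
        have e : ∀ (a : MvPolynomial (ι × (Fin n →₀ ℕ)) k) Λ, fieldEmb k ι ρ a *
          MvPolynomial.X ((Sum.inr r' : ι ⊕ ρ), (Λ : Fin n →₀ ℕ)) * fieldEmb k ι ρ (EL k ι i L)
          = fieldEmb k ι ρ (a * EL k ι i L) *
            MvPolynomial.X ((Sum.inr r' : ι ⊕ ρ), (Λ : Fin n →₀ ℕ)) := by
          intro a Λ; rw [map_mul]; ring
        rw [add_mul, Finset.sum_mul, e, map_add, map_sum, auxE_lin]
        simp only [e, auxE_lin]
        by_cases h : r' = r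
        · subst h
          simp only [if_true, auxD_zero, auxD_single, map_sub, map_sum, ← aux_emb_td]
          simp only [LinearMap.neg_apply, Module.End.one_apply, Finset.sum_neg_distrib,
            sub_eq_add_neg]
          rfl
        · simp [h]
      simp only [key]
      rw [Finset.sum_ite_eq' B r, if_pos (Finset.mem_insert_self _ _)]
    · intro i h
      by_contra hc
      obtain ⟨h0, h1⟩ := hA i (by simpa using hc)
      exact h (by simp [h0, h1])
  · rintro ⟨i, r'⟩ h
    by_contra hc
    obtain ⟨h0, h1⟩ := hAB i r' (by rwa [Finset.mem_coe] at hc)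
    exact h (by simp [h0, h1])
end
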